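/- arXiv:2403.07659 — 3 statements merged into one kernel-verified Lean document; each statement's English description precedes it below -/
import Mathlib

section
/- Let n > 1 and ϑ ≥ 1 be integers, and let m be a positive divisor of ϑ such that m divides n^l for some integer l ≥ 0 (equivalently, every prime dividing m also divides n). Then m divides n^d, where d = ⌊log₂ ϑ⌋ is the integer part of the base-2 logarithm of ϑ. -/
/-- If `m` is a positive divisor of `ϑ` such that `m` divides some power of `n`
(`n > 1`, `ϑ ≥ 1`), then `m` divides `n ^ ⌊log₂ ϑ⌋`. -/
theorem stmt2 (n ϑ m : ℕ) (hn : 1 < n) (hϑ : 1 ≤ ϑ) (hm : 0 < m)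
    (hmϑ : m ∣ ϑ) (hml : ∃ l : ℕ, m ∣ n ^ l) :
    m ∣ n ^ Nat.log 2 ϑ := by
  obtain ⟨l, hl⟩ := hml
  refine (Nat.dvd_iff_prime_pow_dvd_dvd _ _).2 fun p k hp hpk ↦ ?_
  rcases Nat.eq_zero_or_pos k with rfl | hk
  · simp
  have hpn : p ∣ n :=
    hp.dvd_of_dvd_pow ((dvd_pow_self p hk.ne').trans (hpk.trans hl))
  have hkd : k ≤ Nat.log 2 ϑ := Nat.le_log_of_pow_le one_lt_two <|
    (Nat.pow_le_pow_left hp.two_le k).trans (Nat.le_of_dvd hϑ (hpk.trans hmϑ))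
  exact (pow_dvd_pow_of_dvd hpn k).trans (pow_dvd_pow n hkd)
end

section
/- Let K be a nonarchimedean local field whose residue field has characteristic p > 2, and let L/K be a finite separable field extension of even degree. Then L contains a quadratic subextension of K, i.e., there exists an intermediate field F with K ⊆ F ⊆ L and [F:K] = 2. -/
/-- Every element of a finite field becomes a square in an extension of even degree. -/
theorem FiniteField.isSquare_algebraMap_of_even_finrank {k l : Type*} [Field k] [Field l]
    [Finite l] [Algebra k l] (h : Even (Module.finrank k l)) (a : k) :
    IsSquare (algebraMap k l a) := by
  have : Finite k := .of_injective _ (algebraMap k l).injective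
  have := Fintype.ofFinite k
  have := Fintype.ofFinite l
  by_cases hchar : ringChar l = 2
  · exact FiniteField.isSquare_of_char_two hchar _
  rcases eq_or_ne a 0 with rfl | ha
  · simp
  rw [FiniteField.isSquare_iff hchar (by simpa using ha), ← map_pow]
  have hk : Fintype.card k % 2 = 1 :=
    FiniteField.odd_card_of_char_ne_two (by rwa [Algebra.ringChar_eq k l])
  obtain ⟨m, hm⟩ := even_iff_two_dvd.mp h
  have hcard : Fintype.card l = (Fintype.card k ^ 2) ^ m := by
    rw [← pow_mul, ← hm, Module.card_eq_pow_finrank (K := k)]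
  obtain ⟨r, hr⟩ : 2 * (Fintype.card k - 1) ∣ Fintype.card l - 1 := by
    rw [hcard]
    refine Dvd.dvd.trans ?_ (by simpa using Nat.sub_dvd_pow_sub_pow (Fintype.card k ^ 2) 1 m)
    rw [show Fintype.card k ^ 2 - 1 = (Fintype.card k + 1) * (Fintype.card k - 1) by
      simpa using Nat.sq_sub_sq (Fintype.card k) 1]
    exact mul_dvd_mul_right (by omega) _
  have hdiv : Fintype.card l / 2 = (Fintype.card k - 1) * r := by
    have : 0 < Fintype.card l := Fintype.card_pos
    have := FiniteField.odd_card_of_char_ne_two hchar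
    rw [mul_assoc] at hr
    omega
  rw [hdiv, pow_mul, FiniteField.pow_card_sub_one_eq_one a ha, one_pow, map_one]

/-- In a finite field, the product of two nonsquares is a square. -/
theorem FiniteField.isSquare_mul_of_not_isSquare {k : Type*} [Field k] [Finite k] {a b : k}
    (ha : ¬IsSquare a) (hb : ¬IsSquare b) : IsSquare (a * b) := by
  classical
  have := Fintype.ofFinite k
  have ha0 : a ≠ 0 := by rintro rfl; simp at ha
  have hb0 : b ≠ 0 := by rintro rfl; simp at hb
  rw [← quadraticChar_one_iff_isSquare (mul_ne_zero ha0 hb0), map_mul,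
    quadraticChar_neg_one_iff_not_isSquare.mpr ha, quadraticChar_neg_one_iff_not_isSquare.mpr hb]
  norm_num

open IsLocalRing in
theorem IsLocalRing.isSquare_of_isSquare_residue {B : Type*} [CommRing B] [IsLocalRing B]
    (hB : ∀ x : B, x - 1 ∈ maximalIdeal B → IsSquare x) {x : B} (hx : IsUnit x)
    (h : IsSquare (residue B x)) : IsSquare x := by
  obtain ⟨s', hs'⟩ := h
  obtain ⟨s, rfl⟩ := residue_surjective s'
  have hs : IsUnit s := by
    by_contra hs
    rw [← mem_nonunits_iff, ← mem_maximalIdeal, ← residue_eq_zero_iff] at hs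
    rw [hs, mul_zero, residue_eq_zero_iff] at hs'
    exact hs' hx
  obtain ⟨s, rfl⟩ := hs
  have hmul : x = ((s⁻¹ : Bˣ) * (s⁻¹ : Bˣ) * x) * (s * s) := by
    linear_combination (-x * (s⁻¹ : Bˣ) * s - x) * s.inv_mul
  rw [hmul]
  refine (hB _ ?_).mul ⟨_, rfl⟩
  rw [← residue_eq_zero_iff, map_sub, map_mul, hs', map_mul, map_one, mul_mul_mul_comm,
    ← map_mul, s.inv_mul]
  simp

open IsLocalRing in
theorem IsLocalRing.exists_not_isSquare_isSquare_algebraMap {A B : Type*} [CommRing A]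
    [IsDomain A] [IsDiscreteValuationRing A] [CommRing B] [IsDomain B] [IsDiscreteValuationRing B]
    [Algebra A B] [Module.Finite A B] [FaithfulSMul A B] [Finite (ResidueField A)]
    (h2 : ringChar (ResidueField A) ≠ 2) (hB : ∀ x : B, x - 1 ∈ maximalIdeal B → IsSquare x)
    (heven : Even (Module.finrank A B)) :
    ∃ a : A, ¬IsSquare a ∧ IsSquare (algebraMap A B a) := by
  have : Finite (ResidueField B) := Module.finite_of_finite (ResidueField A)
  have hres (a : A) : residue B (algebraMap A B a) =
    algebraMap (ResidueField A) (ResidueField B) (residue A a) := rfl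
  obtain ⟨u', hu'⟩ := FiniteField.exists_nonsquare h2
  obtain ⟨u, rfl⟩ := residue_surjective u'
  have hu : ¬IsSquare u := fun h ↦ hu' (h.map _)
  have huu : IsUnit u := by
    by_contra h
    rw [← mem_nonunits_iff, ← mem_maximalIdeal, ← residue_eq_zero_iff] at h
    simp [h] at hu'
  by_cases huB : IsSquare (algebraMap A B u)
  · exact ⟨u, hu, huB⟩
  have huB' : ¬IsSquare (residue B (algebraMap A B u)) := fun h ↦
    huB (isSquare_of_isSquare_residue hB (huu.map _) h)
  have hfodd : ¬Even (Module.finrank (ResidueField A) (ResidueField B)) := fun h ↦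
    huB' (by rw [hres]; exact FiniteField.isSquare_algebraMap_of_even_finrank h _)
  obtain ⟨π, hπ⟩ := IsDiscreteValuationRing.exists_irreducible A
  obtain ⟨ϖ, hϖ⟩ := IsDiscreteValuationRing.exists_irreducible B
  have hπB : algebraMap A B π ≠ 0 := by simpa using hπ.ne_zero
  obtain ⟨n, w, hw⟩ := IsDiscreteValuationRing.eq_unit_mul_pow_irreducible hπB hϖ
  have hn : Even n := by
    have hmap : (maximalIdeal A).map (algebraMap A B) = maximalIdeal B ^ n := by
      rw [hπ.maximalIdeal_eq, hϖ.maximalIdeal_eq, Ideal.map_span, Set.image_singleton, hw,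
        Ideal.span_singleton_mul_left_unit w.isUnit, Ideal.span_singleton_pow]
    have hB0 : maximalIdeal B ≠ ⊥ := IsDiscreteValuationRing.not_a_field B
    have he : (maximalIdeal B).ramificationIdx A = n := by
      rw [Ideal.IsDedekindDomain.ramificationIdx_eq_multiplicity (maximalIdeal A), hmap,
        multiplicity_pow_self hB0]
      · simpa [Ideal.isUnit_iff] using (maximalIdeal.isMaximal B).ne_top
      · rw [hmap]
        exact pow_ne_zero _ hB0
    have hf := Ideal.inertiaDeg_eq_of_isMaximal (maximalIdeal A) (maximalIdeal B)
    have : Unique ((maximalIdeal A).primesOver B) := by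
      rw [IsLocalRing.primesOver_eq B (IsDiscreteValuationRing.not_a_field A)]
      exact Set.uniqueSingleton _
    have hdef : (default : (maximalIdeal A).primesOver B).1 = maximalIdeal B := by
      simpa only [IsLocalRing.primesOver_eq B (IsDiscreteValuationRing.not_a_field A),
        Set.mem_singleton_iff] using (default : (maximalIdeal A).primesOver B).2
    have hef := Ideal.sum_ramification_inertia_eq_finrank (maximalIdeal A) B
    rw [Fintype.sum_unique, hdef, he, hf] at hef
    rw [← hef, Nat.even_mul] at heven
    exact heven.resolve_right hfodd
  have hsq : IsSquare (ϖ ^ n) := hn.isSquare_pow ϖ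
  have hπsq {v : A} (hv : IsUnit v) : ¬IsSquare (v * π) := by
    obtain ⟨v, rfl⟩ := hv
    exact ((irreducible_units_mul v).2 hπ).not_isSquare
  by_cases hwsq : IsSquare (w : B)
  · exact ⟨π, by simpa using hπsq isUnit_one, hw ▸ hwsq.mul hsq⟩
  · refine ⟨u * π, hπsq huu, ?_⟩
    rw [map_mul, hw, ← mul_assoc]
    refine .mul (isSquare_of_isSquare_residue hB ((huu.map _).mul w.isUnit) ?_) hsq
    rw [map_mul]
    exact FiniteField.isSquare_mul_of_not_isSquare huB' fun h ↦
      hwsq (isSquare_of_isSquare_residue hB w.isUnit h)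

theorem ValuationSubring.mem_integralClosure_iff_spectralNorm_le_one {K L : Type*}
    [NontriviallyNormedField K] [Field L] [Algebra K L] [Algebra.IsAlgebraic K L]
    (A : ValuationSubring K) (hA : ∀ x : K, x ∈ A ↔ ‖x‖ ≤ 1) (x : L) :
    x ∈ integralClosure A L ↔ spectralNorm K L x ≤ 1 := by
  have hx : IsIntegral K x := Algebra.IsIntegral.isIntegral x
  rw [mem_integralClosure_iff, spectralNorm, spectralValue_le_one_iff (minpoly.monic hx)]
  constructor
  · intro h n
    rw [minpoly.isIntegrallyClosed_eq_field_fractions' K h, Polynomial.coeff_map, ← hA]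
    exact ((minpoly A x).coeff n).2
  · intro h
    have hl : minpoly K x ∈ Polynomial.lifts (algebraMap A K) := by
      rw [Polynomial.lifts_iff_coeff_lifts]
      exact fun n ↦ ⟨⟨_, (hA _).2 (h n)⟩, rfl⟩
    obtain ⟨q, hq, -, hmonic⟩ :=
      Polynomial.lifts_and_natDegree_eq_and_monic hl (minpoly.monic hx)
    refine ⟨q, hmonic, ?_⟩
    rw [← Polynomial.aeval_def, ← Polynomial.aeval_map_algebraMap K, hq, minpoly.aeval]

/-- In a complete nonarchimedean field of residue characteristic different from two, every element
congruent to `1` modulo the maximal ideal is a square. -/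
theorem IsUltrametricDist.isSquare_of_norm_sub_one_lt {L : Type*} [NormedField L] [CompleteSpace L]
    [IsUltrametricDist L] (h2 : ‖(2 : L)‖ = 1) {x : L} (hx : ‖x - 1‖ < 1) : IsSquare x := by
  have h20 : (2 : L) ≠ 0 := fun h ↦ by simp [h] at h2
  let f : L → L := fun z ↦ (x - 1 - z ^ 2) / 2
  let s : Set L := Metric.closedBall 0 ‖x - 1‖
  have hmaps : Set.MapsTo f s s := by
    intro z hz
    simp only [s, mem_closedBall_zero_iff] at hz ⊢
    rw [norm_div, h2, div_one]
    rw [sub_eq_add_neg]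
    refine (IsUltrametricDist.norm_add_le_max _ _).trans (max_le le_rfl ?_)
    rw [norm_neg, norm_pow]
    nlinarith [norm_nonneg z]
  have hf : ContractingWith ‖x - 1‖₊ (hmaps.restrict f s s) := by
    refine ⟨hx, LipschitzWith.of_dist_le_mul fun ⟨z, hz⟩ ⟨w, hw⟩ ↦ ?_⟩
    simp only [s, mem_closedBall_zero_iff] at hz hw
    simp only [Subtype.dist_eq, Set.MapsTo.val_restrict_apply, dist_eq_norm, coe_nnnorm]
    have : f z - f w = (w + z) * (w - z) / 2 := by simp only [f]; ring
    rw [this, norm_div, norm_mul, h2, div_one, norm_sub_rev]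
    gcongr
    exact (IsUltrametricDist.norm_add_le_max _ _).trans (max_le hw hz)
  obtain ⟨y, -, hy, -⟩ := hf.exists_fixedPoint' (Metric.isClosed_closedBall.isComplete) hmaps
    (x := 0) (by simp [s]) (edist_ne_top _ _)
  refine ⟨1 + y, ?_⟩
  have : (x - 1 - y ^ 2) / 2 = y := hy
  rw [div_eq_iff h20] at this
  linear_combination this

open IsLocalRing in
theorem ValuationSubring.isLocalRing_integralClosure {K L : Type*} [NontriviallyNormedField K]
    [IsUltrametricDist K] [CompleteSpace K] [Field L] [Algebra K L] [FiniteDimensional K L]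
    (A : ValuationSubring K) (hA : ∀ x : K, x ∈ A ↔ ‖x‖ ≤ 1) (h2 : ‖(2 : K)‖ = 1) :
    ∃ _ : IsLocalRing (integralClosure A L),
      ∀ x : integralClosure A L, x - 1 ∈ maximalIdeal _ → IsSquare x := by
  let := spectralNorm.normedField K L
  let := spectralNorm.normedAlgebra K L
  have : CompleteSpace L := spectralNorm.completeSpace K L
  have : IsUltrametricDist L := ⟨fun x y z ↦ by
    have := isNonarchimedean_spectralNorm (K := K) (L := L) (x - y) (y - z)
    rwa [sub_add_sub_cancel] at this⟩
  have hmem (x : L) : x ∈ integralClosure A L ↔ ‖x‖ ≤ 1 :=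
    A.mem_integralClosure_iff_spectralNorm_le_one hA x
  have hunit (x : integralClosure A L) : ‖(x : L)‖ < 1 ↔
      x ∈ _root_.nonunits (integralClosure A L) := by
    rw [_root_.mem_nonunits_iff, ← not_le, not_iff_not]
    constructor
    · intro h
      have hx : (x : L) ≠ 0 := fun h0 ↦ by simp [h0] at h; linarith
      refine .of_mul_eq_one ⟨(x : L)⁻¹, (hmem _).2 ?_⟩ (Subtype.ext (mul_inv_cancel₀ hx))
      rw [norm_inv]
      exact inv_le_one_of_one_le₀ h
    · intro h
      obtain ⟨y, hy⟩ := h.exists_right_inv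
      have := congrArg (fun z : integralClosure A L ↦ ‖(z : L)‖) hy
      simp only [MulMemClass.coe_mul, norm_mul, OneMemClass.coe_one, norm_one] at this
      rw [← this]
      exact mul_le_of_le_one_right (norm_nonneg _) ((hmem _).1 y.2)
  have hloc : IsLocalRing (integralClosure A L) := .of_nonunits_add fun a b ha hb ↦ by
    rw [← hunit] at ha hb ⊢
    exact (IsUltrametricDist.norm_add_le_max _ _).trans_lt (max_lt ha hb)
  refine ⟨hloc, fun x hx ↦ ?_⟩
  rw [mem_maximalIdeal, ← hunit] at hx
  have h2L : ‖(2 : L)‖ = 1 := by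
    rw [← h2, ← map_ofNat (algebraMap K L) 2]
    exact spectralNorm_extends _
  obtain ⟨r, hr⟩ := IsUltrametricDist.isSquare_of_norm_sub_one_lt h2L hx
  have hr1 : ‖r‖ ≤ 1 := by
    have := (hmem _).1 x.2
    rw [hr, norm_mul] at this
    nlinarith [norm_nonneg r]
  exact ⟨⟨r, (hmem r).2 hr1⟩, Subtype.ext hr⟩

theorem exists_intermediateField_finrank_eq_two {K L : Type*} [Field K] [Field L] [Algebra K L]
    {a : K} (ha : ¬IsSquare a) (hL : IsSquare (algebraMap K L a)) :
    ∃ F : IntermediateField K L, Module.finrank K F = 2 := by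
  obtain ⟨x, hx⟩ := hL
  have hirr : Irreducible (Polynomial.X ^ 2 - Polynomial.C a) := by
    refine X_pow_sub_C_irreducible_of_prime Nat.prime_two fun b hb ↦ ha ⟨b, ?_⟩
    rw [← hb, sq]
  have hmin : minpoly K x = Polynomial.X ^ 2 - Polynomial.C a :=
    (minpoly.eq_of_irreducible_of_monic hirr (by simp [hx, sq])
      (Polynomial.monic_X_pow_sub_C a two_ne_zero)).symm
  have hint : IsIntegral K x :=
    ⟨_, Polynomial.monic_X_pow_sub_C a two_ne_zero, by simp [hx, sq]⟩
  refine ⟨IntermediateField.adjoin K {x}, ?_⟩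
  rw [IntermediateField.adjoin.finrank hint, hmin, Polynomial.natDegree_X_pow_sub_C]

theorem Valuation.IsRankOneDiscrete.of_surjective {K : Type*} [Field K]
    {v : Valuation K (WithZero (Multiplicative ℤ))} (hv : Function.Surjective v) :
    v.IsRankOneDiscrete := by
  refine ⟨Units.mk0 (WithZero.exp (-1 : ℤ)) (by simp), ?_, ?_⟩
  · ext n
    simp only [Subgroup.mem_zpowers_iff, MonoidWithZeroHom.mem_valueGroup_iff_of_comm]
    constructor
    · rintro -
      obtain ⟨x, hx⟩ := hv n
      exact ⟨1, by simp, x, by simp [hx]⟩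
    · rintro -
      refine ⟨-WithZero.log (n : WithZero (Multiplicative ℤ)), Units.ext ?_⟩
      simp
  · exact compareOfLessAndEq_eq_lt.mp rfl

/-- Let `K` be a nonarchimedean local field (a field complete with respect to a
discrete valuation `v : K → ℤₘ₀`, with finite residue field) of residue
characteristic `p > 2`, and let `L/K` be a finite separable extension of even
degree.  Then `L` contains a quadratic subextension of `K`. -/
theorem stmt7 (K : Type) [Field K]
    [vK : Valued K (WithZero (Multiplicative ℤ))] [CompleteSpace K]
    (hdisc : Function.Surjective vK.v)
    [Finite (IsLocalRing.ResidueField vK.v.valuationSubring)]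
    (p : ℕ) (hp : 2 < p)
    [CharP (IsLocalRing.ResidueField vK.v.valuationSubring) p]
    (L : Type) [Field L] [Algebra K L] [FiniteDimensional K L]
    [Algebra.IsSeparable K L] (heven : Even (Module.finrank K L)) :
    ∃ F : IntermediateField K L, Module.finrank K F = 2 := by
  have := Valuation.IsRankOneDiscrete.of_surjective hdisc
  let := Valuation.IsRankOneDiscrete.rankOne vK.v (e := 2) one_lt_two
  let : NontriviallyNormedField K :=
    Valued.toNontriviallyNormedField K (WithZero (Multiplicative ℤ))
  have hA (x : K) : x ∈ vK.v.valuationSubring ↔ ‖x‖ ≤ 1 :=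
    (Valuation.mem_valuationSubring_iff _ _).trans
      (Valued.toNormedField.norm_le_one_iff (val := vK)).symm
  have hchar : ringChar (IsLocalRing.ResidueField vK.v.valuationSubring) ≠ 2 := by
    rw [ringChar.eq _ p]
    exact hp.ne'
  have h2 : ‖(2 : K)‖ = 1 := by
    have : IsUnit (2 : vK.v.valuationSubring) := by
      rw [← IsLocalRing.residue_ne_zero_iff_isUnit, map_ofNat]
      exact Ring.two_ne_zero hchar
    obtain ⟨y, hy⟩ := this.exists_right_inv
    have h := congrArg (fun z : vK.v.valuationSubring ↦ ‖(z : K)‖) hy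
    simp only [MulMemClass.coe_mul, norm_mul, OneMemClass.coe_one, norm_one] at h
    refine le_antisymm ((hA _).1 (2 : vK.v.valuationSubring).2) ?_
    rw [← h]
    exact mul_le_of_le_one_right (norm_nonneg _) ((hA _).1 y.2)
  obtain ⟨hloc, hsq⟩ := vK.v.valuationSubring.isLocalRing_integralClosure (L := L) hA h2
  set A := vK.v.valuationSubring
  have : IsDiscreteValuationRing A := inferInstance
  have : Module.Finite A (integralClosure A L) := IsIntegralClosure.finite A K L _
  have : IsDedekindDomain (integralClosure A L) := integralClosure.isDedekindDomain A K L
  have : FaithfulSMul A (integralClosure A L) := by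
    rw [faithfulSMul_iff_algebraMap_injective]
    intro x y hxy
    have := congrArg (algebraMap (integralClosure A L) L) hxy
    rw [← IsScalarTower.algebraMap_apply, ← IsScalarTower.algebraMap_apply] at this
    exact FaithfulSMul.algebraMap_injective A L this
  have hfield : ¬IsField (integralClosure A L) := fun h ↦
    IsDiscreteValuationRing.not_isField A
      (isField_of_isIntegral_of_isField (FaithfulSMul.algebraMap_injective A _) h)
  have : IsDiscreteValuationRing (integralClosure A L) :=
    ((IsDiscreteValuationRing.TFAE _ hfield).out 0 2).2 ‹IsDedekindDomain _›
  obtain ⟨a, ha, r, hr⟩ := IsLocalRing.exists_not_isSquare_isSquare_algebraMap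
    (A := A) (B := integralClosure A L) hchar hsq
    (by rwa [IsIntegralClosure.rank A K L (integralClosure A L)])
  refine exists_intermediateField_finrank_eq_two (a := (a : K)) ?_ ⟨r, ?_⟩
  · rintro ⟨s, hs⟩
    refine ha ⟨⟨s, (hA s).2 ?_⟩, Subtype.ext hs⟩
    have := (hA _).1 a.2
    rw [hs, norm_mul] at this
    nlinarith [norm_nonneg s]
  · exact congrArg (algebraMap (integralClosure A L) L) hr
end

section
/- Let Γ be a finite group and M a finitely generated module over the group ring ℤ[Γ]. Then there exists a short exact sequence of ℤ[Γ]-modules 0 → M⁻¹ → M⁰ → M → 0 in which M⁻¹ is a finitely generated free ℤ[Γ]-module, and M⁰ is torsion-free as an abelian group of rank at most #Γ · gen(M), where gen(M) denotes the minimal number of generators of M as an abelian group. -/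
/-- The minimal number of generators of an additive commutative group `M`
(as an abelian group, i.e. as a `ℤ`-module). -/
noncomputable def genAb (M : Type) [AddCommGroup M] : ℕ :=
  sInf {n : ℕ | ∃ s : Finset M, s.card = n ∧ Submodule.span ℤ (s : Set M) = ⊤}

section IntegralGroupRing

open MonoidAlgebra

variable {Γ ι κ : Type}

/-- The coefficients at `γ` of a vector over the integral group ring. -/
def coeffAt (γ : Γ) : (ι → MonoidAlgebra ℤ Γ) →ₗ[ℤ] (ι → ℤ) where
  toFun x i := (x i).coeff γ
  map_add' _ _ := rfl
  map_smul' _ _ := rfl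

@[simp]
lemma coeffAt_apply (γ : Γ) (x : ι → MonoidAlgebra ℤ Γ) (i : ι) :
    coeffAt γ x i = (x i).coeff γ := rfl

/-- Vectors over the integral group ring of a finite group, as families of integer vectors. -/
noncomputable def coeffAtEquiv [Finite Γ] :
    (ι → MonoidAlgebra ℤ Γ) ≃ₗ[ℤ] (Γ → ι → ℤ) where
  toFun x γ := coeffAt γ x
  invFun a i := .ofCoeff (Finsupp.equivFunOnFinite.symm fun γ => a γ i)
  map_add' _ _ := rfl
  map_smul' _ _ := rfl
  left_inv x := by
    ext i γ
    simp
  right_inv a := by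
    ext γ i
    simp

lemma finite_pi_groupRing [Finite Γ] [Finite ι] :
    Module.Finite ℤ (ι → MonoidAlgebra ℤ Γ) :=
  Module.Finite.equiv coeffAtEquiv.symm

lemma finrank_pi_groupRing [Finite Γ] [Fintype ι] :
    Module.finrank ℤ (ι → MonoidAlgebra ℤ Γ) = Nat.card Γ * Fintype.card ι := by
  have := Fintype.ofFinite Γ
  rw [coeffAtEquiv.finrank_eq, Module.finrank_pi_fintype]
  simp

variable [Group Γ]

lemma coeffAt_single_smul (γ h : Γ) (a : ℤ) (x : ι → MonoidAlgebra ℤ Γ) :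
    coeffAt γ (single h a • x) = a • coeffAt (h⁻¹ * γ) x := by
  ext i
  simp

variable {M : Type} [AddCommGroup M] [Module (MonoidAlgebra ℤ Γ) M]

lemma single_smul_eq_zsmul (h : Γ) (a : ℤ) (m : M) :
    (single h a : MonoidAlgebra ℤ Γ) • m = a • (single h (1 : ℤ) : MonoidAlgebra ℤ Γ) • m := by
  rw [← smul_assoc, smul_single, smul_eq_mul, mul_one]

lemma apply_coeffAt_smul (π : (ι → ℤ) →ₗ[ℤ] M) {x : ι → MonoidAlgebra ℤ Γ}
    (hx : ∀ γ, π (coeffAt γ x) = (single γ⁻¹ 1 : MonoidAlgebra ℤ Γ) • π (coeffAt 1 x))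
    (r : MonoidAlgebra ℤ Γ) (γ : Γ) :
    π (coeffAt γ (r • x)) = (single γ⁻¹ 1 : MonoidAlgebra ℤ Γ) • r • π (coeffAt 1 x) := by
  induction r using induction_linear with
  | zero => simp
  | add r s hr hs => simp only [add_smul, map_add, smul_add, hr, hs]
  | single h a =>
    rw [coeffAt_single_smul, map_smul, hx, smul_smul, single_mul_single, one_mul,
      single_smul_eq_zsmul _ a, mul_inv_rev, inv_inv]

/-- The pullback of the coinduced module of `ι → ℤ` along the embedding of `M` into its
coinduced module. -/
noncomputable def equivariantVectors (π : (ι → ℤ) →ₗ[ℤ] M) :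
    Submodule (MonoidAlgebra ℤ Γ) (ι → MonoidAlgebra ℤ Γ) where
  carrier := {x | ∀ γ, π (coeffAt γ x) =
    (single γ⁻¹ 1 : MonoidAlgebra ℤ Γ) • π (coeffAt 1 x)}
  zero_mem' γ := by simp
  add_mem' hx hy γ := by simp only [map_add, smul_add, hx γ, hy γ]
  smul_mem' r x hx γ := by
    rw [apply_coeffAt_smul π hx, apply_coeffAt_smul π hx r 1, inv_one, ← one_def, one_smul]

/-- The projection of the pullback onto `M`. -/
noncomputable def equivariantVectorsProj (π : (ι → ℤ) →ₗ[ℤ] M) :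
    equivariantVectors (Γ := Γ) π →ₗ[MonoidAlgebra ℤ Γ] M where
  toFun x := π (coeffAt 1 x.1)
  map_add' _ _ := by simp
  map_smul' r x := by
    have h := apply_coeffAt_smul π x.2 r 1
    rwa [inv_one, ← one_def, one_smul] at h

lemma equivariantVectorsProj_surjective [Finite Γ] {π : (ι → ℤ) →ₗ[ℤ] M}
    (hπ : Function.Surjective π) :
    Function.Surjective (equivariantVectorsProj (Γ := Γ) π) := by
  intro m
  choose a ha using fun γ : Γ => hπ ((single γ⁻¹ 1 : MonoidAlgebra ℤ Γ) • m)
  have h (γ : Γ) : coeffAt γ (coeffAtEquiv.symm a) = a γ :=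
    congrFun (coeffAtEquiv.apply_symm_apply a) γ
  have h1 : π (a 1) = m := by rw [ha, inv_one, ← one_def, one_smul]
  refine ⟨⟨coeffAtEquiv.symm a, fun γ => ?_⟩, ?_⟩
  · rw [h, h, h1, ha]
  · exact (congrArg π (h 1)).trans h1

/-- The extension of scalars, to the integral group ring, of the linear map given by a family
of integer vectors. -/
noncomputable def extendScalars [Fintype κ] (b : κ → ι → ℤ) :
    (κ → MonoidAlgebra ℤ Γ) →ₗ[MonoidAlgebra ℤ Γ] (ι → MonoidAlgebra ℤ Γ) :=
  Fintype.linearCombination (MonoidAlgebra ℤ Γ) fun j i => single 1 (b j i)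

lemma coeffAt_extendScalars [Fintype κ] (b : κ → ι → ℤ) (y : κ → MonoidAlgebra ℤ Γ) (γ : Γ) :
    coeffAt γ (extendScalars b y) = Fintype.linearCombination ℤ b (coeffAt γ y) := by
  ext i
  simp [extendScalars, Fintype.linearCombination_apply, coeff_sum]

lemma extendScalars_injective [Fintype κ] {b : κ → ι → ℤ} (hb : LinearIndependent ℤ b) :
    Function.Injective (extendScalars (Γ := Γ) b) := by
  intro y z h
  ext j γ
  have hγ : Fintype.linearCombination ℤ b (coeffAt γ y) =
      Fintype.linearCombination ℤ b (coeffAt γ z) := by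
    rw [← coeffAt_extendScalars, h, coeffAt_extendScalars]
  exact congrFun (hb.fintypeLinearCombination_injective hγ) j

lemma mem_range_extendScalars [Finite Γ] [Fintype κ] (b : κ → ι → ℤ)
    (x : ι → MonoidAlgebra ℤ Γ) :
    x ∈ LinearMap.range (extendScalars (Γ := Γ) b) ↔
      ∀ γ, coeffAt γ x ∈ Submodule.span ℤ (Set.range b) := by
  simp only [← Fintype.range_linearCombination ℤ b, LinearMap.mem_range]
  constructor
  · rintro ⟨y, rfl⟩ γ
    exact ⟨_, (coeffAt_extendScalars b y γ).symm⟩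
  · intro h
    choose a ha using h
    refine ⟨coeffAtEquiv.symm a, coeffAtEquiv.injective (funext fun γ => ?_)⟩
    refine (coeffAt_extendScalars b _ γ).trans ?_
    rw [show coeffAt γ (coeffAtEquiv.symm a) = a γ from
      congrFun (coeffAtEquiv.apply_symm_apply a) γ, ha]
    rfl

lemma equivariantVectorsProj_eq_zero_iff (π : (ι → ℤ) →ₗ[ℤ] M)
    (x : equivariantVectors (Γ := Γ) π) :
    equivariantVectorsProj π x = 0 ↔ ∀ γ, π (coeffAt γ x.1) = 0 := by
  refine ⟨fun h γ => ?_, fun h => h 1⟩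
  rw [x.2 γ, show π (coeffAt 1 x.1) = 0 from h, smul_zero]

end IntegralGroupRing

lemma exists_finset_card_eq_genAb (M : Type) [AddCommGroup M] [Module.Finite ℤ M] :
    ∃ s : Finset M, s.card = genAb M ∧ Submodule.span ℤ (s : Set M) = ⊤ := by
  obtain ⟨s, hs⟩ := Module.Finite.fg_top (R := ℤ) (M := M)
  exact Nat.sInf_mem (s := {n : ℕ | ∃ s : Finset M, s.card = n ∧
    Submodule.span ℤ (s : Set M) = ⊤}) ⟨_, s, rfl, hs⟩

/-- Let `Γ` be a finite group and `M` a finitely generated module over the group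
ring `ℤ[Γ]`.  Then there is a short exact sequence of `ℤ[Γ]`-modules
`0 → M⁻¹ → M⁰ → M → 0` with `M⁻¹` a finitely generated free `ℤ[Γ]`-module and
`M⁰` torsion-free as an abelian group, of rank at most `#Γ · gen(M)`. -/
theorem stmt9 (Γ : Type) [Group Γ] [Finite Γ]
    (M : Type) [AddCommGroup M] [Module (MonoidAlgebra ℤ Γ) M]
    [Module.Finite (MonoidAlgebra ℤ Γ) M] :
    ∃ (Mm : Type) (_ : AddCommGroup Mm) (_ : Module (MonoidAlgebra ℤ Γ) Mm)
      (M0 : Type) (_ : AddCommGroup M0) (_ : Module (MonoidAlgebra ℤ Γ) M0)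
      (f : Mm →ₗ[MonoidAlgebra ℤ Γ] M0) (g : M0 →ₗ[MonoidAlgebra ℤ Γ] M),
        Function.Injective f ∧ Function.Surjective g ∧
        LinearMap.range f = LinearMap.ker g ∧
        Module.Free (MonoidAlgebra ℤ Γ) Mm ∧
        Module.Finite (MonoidAlgebra ℤ Γ) Mm ∧
        NoZeroSMulDivisors ℤ M0 ∧
        Module.Finite ℤ M0 ∧
        Module.finrank ℤ M0 ≤ Nat.card Γ * genAb M := by
  have : Module.Finite ℤ (MonoidAlgebra ℤ Γ) :=
    Module.Finite.equiv
      ((LinearEquiv.funUnique Unit ℤ (MonoidAlgebra ℤ Γ)).symm.trans coeffAtEquiv).symm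
  have : Module.Finite ℤ M := Module.Finite.trans (MonoidAlgebra ℤ Γ) M
  obtain ⟨s, hcard, hspan⟩ := exists_finset_card_eq_genAb M
  let π : (s → ℤ) →ₗ[ℤ] M := Fintype.linearCombination ℤ ((↑) : s → M)
  have hπ : Function.Surjective π := by
    rw [← LinearMap.range_eq_top, Fintype.range_linearCombination, Subtype.range_coe]
    exact hspan
  obtain ⟨n, b⟩ := Submodule.basisOfPid (Pi.basisFun ℤ s) (LinearMap.ker π)
  let v : Fin n → s → ℤ := fun j => b j
  have hv : LinearIndependent ℤ v :=
    b.linearIndependent.map' (LinearMap.ker π).subtype (Submodule.ker_subtype _)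
  have hker : Submodule.span ℤ (Set.range v) = LinearMap.ker π := by
    have h := congrArg (Submodule.map (LinearMap.ker π).subtype) b.span_eq
    rwa [Submodule.map_span, ← Set.range_comp, Submodule.map_top, Submodule.range_subtype] at h
  have hmem (x : s → MonoidAlgebra ℤ Γ) :
      x ∈ LinearMap.range (extendScalars (Γ := Γ) v) ↔ ∀ γ, π (coeffAt γ x) = 0 := by
    simp only [mem_range_extendScalars, hker, LinearMap.mem_ker]
  have hf (y : Fin n → MonoidAlgebra ℤ Γ) : extendScalars v y ∈ equivariantVectors π := by
    have h := (hmem _).1 ⟨y, rfl⟩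
    intro γ
    rw [h, h, smul_zero]
  have := finite_pi_groupRing (Γ := Γ) (ι := s)
  let incl : equivariantVectors (Γ := Γ) π →ₗ[ℤ] (s → MonoidAlgebra ℤ Γ) :=
    (equivariantVectors π).subtype.toAddMonoidHom.toIntLinearMap
  have hincl : Function.Injective incl := Subtype.val_injective
  refine ⟨Fin n → MonoidAlgebra ℤ Γ, inferInstance, inferInstance, equivariantVectors (Γ := Γ) π,
    inferInstance, inferInstance, (extendScalars v).codRestrict _ hf, equivariantVectorsProj π,
    fun y z h => extendScalars_injective hv (congrArg Subtype.val h),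
    equivariantVectorsProj_surjective hπ, ?_, inferInstance, inferInstance, ?_,
    Module.Finite.of_injective incl hincl, ?_⟩
  · ext x
    rw [LinearMap.mem_ker, equivariantVectorsProj_eq_zero_iff, ← hmem]
    simp only [LinearMap.mem_range, Subtype.ext_iff, LinearMap.codRestrict_apply]
  · refine ⟨fun {a x} h => or_iff_not_imp_left.2 fun ha => hincl ?_⟩
    rw [map_zero]
    ext i γ
    have h' := congrArg (fun z => (incl z i).coeff γ) h
    simp only [map_smul, map_zero] at h'
    exact (mul_eq_zero.1 h').resolve_left ha
  · rw [← hcard, ← Fintype.card_coe, ← finrank_pi_groupRing]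
    exact LinearMap.finrank_le_finrank_of_injective hincl
end
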